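/- If S is a set of positive integers that is almost closed under addition and the indicator function k ↦ 1_S(k) is computable, then there exists a computable, fully divergent, infinite in limit basic sequence Q such that dim_H(⋂_{k∈S} N_k(Q) \ ⋃_{k∉S} N_k(Q)) = 1. -/

import Mathlib

open Filter MeasureTheory Finset
open scoped Topology Classical

/-- A basic sequence: a sequence of integers, each at least `2`. -/
def IsBasic (q : ℕ → ℕ) : Prop := ∀ n, 2 ≤ q n

/-- The product `q_0 q_1 ⋯ q_{n-1}` of the first `n` terms of the basic sequence. -/
def qprod (q : ℕ → ℕ) (n : ℕ) : ℝ := ∏ i ∈ Finset.range n, (q i : ℝ)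

/-- `T_{Q,n}(x) = (q_0 q_1 ⋯ q_{n-1}) x mod 1`. -/
noncomputable def TQ (q : ℕ → ℕ) (n : ℕ) (x : ℝ) : ℝ := Int.fract (qprod q n * x)

/-- The `n`-th digit `E_n` of the `Q`-Cantor series expansion of `x`
(digit positions are indexed by `0, 1, 2, …`). -/
noncomputable def qdigit (q : ℕ → ℕ) (x : ℝ) (n : ℕ) : ℕ := ⌊(q n : ℝ) * TQ q n x⌋₊

/-- `N_n^Q(B,x)`: the number of occurrences of the block `B` starting among the first `n`
digit positions of the `Q`-Cantor series expansion of `x`. -/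
noncomputable def blockCount (q : ℕ → ℕ) (x : ℝ) {k : ℕ} (B : Fin k → ℕ) (n : ℕ) : ℕ :=
  ((Finset.range n).filter fun i => ∀ j : Fin k, qdigit q x (i + (j : ℕ)) = B j).card

/-- `Q_n^{(k)} = ∑_{j<n} 1/(q_j q_{j+1} ⋯ q_{j+k-1})`. -/
noncomputable def Qsum (q : ℕ → ℕ) (k n : ℕ) : ℝ :=
  ∑ j ∈ Finset.range n, (∏ i ∈ Finset.range k, (q (j + i) : ℝ))⁻¹

/-- `x` is `Q`-normal of order `k`: every block of length `k` occurs with the expected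
asymptotic frequency. -/
def QNormalOfOrder (q : ℕ → ℕ) (k : ℕ) (x : ℝ) : Prop :=
  ∀ B : Fin k → ℕ,
    Tendsto (fun n => (blockCount q x B n : ℝ) / Qsum q k n) atTop (𝓝 1)

/-- `x ∈ N(Q)`: `x` is `Q`-normal of every order `k ≥ 1`. -/
def QNormal (q : ℕ → ℕ) (x : ℝ) : Prop := ∀ k, 1 ≤ k → QNormalOfOrder q k x

/-- `Q` is fully divergent: `Q_n^{(k)} → ∞` for every `k ≥ 1`. -/
def FullyDivergent (q : ℕ → ℕ) : Prop :=
  ∀ k, 1 ≤ k → Tendsto (fun n => Qsum q k n) atTop atTop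

/-- `Q` is infinite in limit: `q_n → ∞`. -/
def InfiniteInLimit (q : ℕ → ℕ) : Prop := Tendsto q atTop atTop

/-- `N_{n,m,r}^Q(B,x)`: occurrences of the block `B` (of length `m`) starting at
positions `i < n` with `i ≡ r (mod m)`. -/
noncomputable def apCount (q : ℕ → ℕ) (x : ℝ) (m r : ℕ) (B : Fin m → ℕ) (n : ℕ) : ℕ :=
  ((Finset.range n).filter fun i =>
    i % m = r ∧ ∀ j : Fin m, qdigit q x (i + (j : ℕ)) = B j).card

/-- `Q_n^{(m,r)} = ∑_{j=0}^{⌊(n-r)/m⌋} 1/(q_{mj+r} q_{mj+r+1} ⋯ q_{mj+r+m-1})`. -/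
noncomputable def apQsum (q : ℕ → ℕ) (m r n : ℕ) : ℝ :=
  ∑ j ∈ Finset.range ((n - r) / m + 1),
    (∏ i ∈ Finset.range m, (q (m * j + r + i) : ℝ))⁻¹

/-- `x ∈ N^{I}_{m,r}(Q)`. -/
def MemNAPI (q : ℕ → ℕ) (m r : ℕ) (x : ℝ) : Prop :=
  ∀ B : Fin m → ℕ,
    Tendsto (fun n => (apCount q x m r B n : ℝ) / apQsum q m r n) atTop (𝓝 1)

/-- `x ∈ N^{I}_{Ab}(Q)`: `x` is AP `Q`-abnormal of type I. -/
def APAbnormalI (q : ℕ → ℕ) (x : ℝ) : Prop :=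
  ∀ m, 2 ≤ m → ∀ r, r < m → ¬ MemNAPI q m r x

/-- `x ∈ RN^{I}(Q)`. -/
def MemRNI (q : ℕ → ℕ) (x : ℝ) : Prop :=
  ∀ m, 1 ≤ m → ∀ r, r < m → ∀ B₁ B₂ : Fin m → ℕ,
    Tendsto (fun n => (apCount q x m r B₁ n : ℝ) / (apCount q x m r B₂ n : ℝ))
      atTop (𝓝 1)

/-- `Λ_{m,r}(Q) = (q_{mt+r})_t`. -/
def lamQ (q : ℕ → ℕ) (m r : ℕ) : ℕ → ℕ := fun t => q (m * t + r)

/-- `Υ_{Q,m,r}(x)`: the real number whose `Λ_{m,r}(Q)`-Cantor series digits are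
`(E_{mt+r})_t`, where `(E_n)` are the `Q`-Cantor series digits of `x`. -/
noncomputable def Ups (q : ℕ → ℕ) (m r : ℕ) (x : ℝ) : ℝ :=
  ∑' t : ℕ, (qdigit q x (m * t + r) : ℝ) / ∏ i ∈ Finset.range (t + 1), (lamQ q m r i : ℝ)

/-- `x ∈ N^{II}_{k,m,r}(Q) = Υ_{Q,m,r}^{-1}(N_k(Λ_{m,r}(Q)))`. -/
def MemNAPII (q : ℕ → ℕ) (k m r : ℕ) (x : ℝ) : Prop :=
  QNormalOfOrder (lamQ q m r) k (Ups q m r x)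

/-- `x ∈ N^{II}(Q)`: `x` is AP `Q`-normal of type II. -/
def APNormalII (q : ℕ → ℕ) (x : ℝ) : Prop :=
  ∀ k, 1 ≤ k → ∀ m, 1 ≤ m → ∀ r, r < m → MemNAPII q k m r x

/-- `x ∈ RN^{II}(Q)`: for all `k, m, r` the counts in `Υ_{Q,m,r}(x)` of any two blocks of
length `k` with respect to `Λ_{m,r}(Q)` have ratio tending to `1`. -/
def MemRNII (q : ℕ → ℕ) (x : ℝ) : Prop :=
  ∀ k, 1 ≤ k → ∀ m, 1 ≤ m → ∀ r, r < m → ∀ B₁ B₂ : Fin k → ℕ,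
    Tendsto (fun n =>
      (blockCount (lamQ q m r) (Ups q m r x) B₁ n : ℝ) /
      (blockCount (lamQ q m r) (Ups q m r x) B₂ n : ℝ)) atTop (𝓝 1)

/-- `S` (a set of positive integers) is almost closed under addition: for every `k ∈ S`,
the set `{x ∉ S : x + k ∈ S}` has asymptotic density `0`. -/
def AlmostClosed (S : Set ℕ) : Prop :=
  ∀ k ∈ S, Tendsto
    (fun t : ℕ => (((Finset.Icc 1 t).filter fun x => x ∉ S ∧ x + k ∈ S).card : ℝ) / t)
    atTop (𝓝 0)

/-- The sequence `u` of reals is uniformly distributed mod 1. -/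
def UDMod1 (u : ℕ → ℝ) : Prop :=
  ∀ a b : ℝ, 0 ≤ a → a < b → b ≤ 1 →
    Tendsto (fun N => (((Finset.range N).filter fun n => u n ∈ Set.Ico a b).card : ℝ) / N)
      atTop (𝓝 (b - a))

/-- `x ∈ DN(Q)`: `x` is `Q`-distribution normal. -/
def DistNormal (q : ℕ → ℕ) (x : ℝ) : Prop := UDMod1 fun n => TQ q n x

/-- `x ∈ DN_{Ab}(Q)`: `x` is AP `Q`-distribution abnormal. -/
def APDistAbnormal (q : ℕ → ℕ) (x : ℝ) : Prop :=
  ∀ m, 2 ≤ m → ∀ r, r < m → ¬ UDMod1 fun n => TQ q (m * n + r) x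

/-- `y ∈ D_{(x_n)}(Q)`: for every `ξ ∈ (0,1)`, the proportion of `n ≤ N` with
`fract (T_{Q,n}(y) - x_n) < ξ` tends to `1`. -/
def MemD (q : ℕ → ℕ) (xs : ℕ → ℝ) (y : ℝ) : Prop :=
  ∀ ξ : ℝ, 0 < ξ → ξ < 1 →
    Tendsto (fun N =>
      (((Finset.range N).filter fun n => Int.fract (TQ q n y - xs n) < ξ).card : ℝ) / N)
      atTop (𝓝 1)

/-- A computable real number. -/
def ComputableReal (x : ℝ) : Prop :=
  ∃ f : ℕ → ℕ, Computable f ∧ ∀ n : ℕ, 0 < n → (f n : ℝ) / n ≤ x ∧ x ≤ ((f n : ℝ) + 1) / n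

/-- The indicator function `1_{ℕ∖S}` of the complement of `S`, with values in `ℤ`. -/
noncomputable def indZ (S : Set ℕ) (i : ℕ) : ℤ := if i ∈ S then 0 else 1

/-- The indicator function `1_{ℕ∖S}` of the complement of `S`, with values in `ℝ`. -/
noncomputable def indR (S : Set ℕ) (i : ℕ) : ℝ := if i ∈ S then 0 else 1

/-- The coefficients `c_{t,i}`: `c_{t,1} = t (1+ε)^{1_{ℕ∖S}(1)}` and
`c_{t,i} = (1+ε)^{1_{ℕ∖S}(i) - 1_{ℕ∖S}(i-1)}` for `i ≥ 2`. -/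
noncomputable def coeff (S : Set ℕ) (ε : ℝ) (t i : ℕ) : ℝ :=
  if i = 1 then (t : ℝ) * (1 + ε) ^ indZ S 1
  else (1 + ε) ^ (indZ S i - indZ S (i - 1))

/-- `N_k(b)`: the set of real numbers normal of order `k` in base `b`. -/
def BaseNormalOfOrder (b k : ℕ) : Set ℝ :=
  {x | ∀ B : Fin k → ℕ, (∀ j, B j < b) →
    Tendsto (fun n => (blockCount (fun _ => b) x B n : ℝ) / n) atTop
      (𝓝 (((b : ℝ) ^ k)⁻¹))}

section Qsum

variable {q : ℕ → ℕ}

theorem Qsum_term_nonneg (k j : ℕ) : 0 ≤ (∏ i ∈ Finset.range k, (q (j + i) : ℝ))⁻¹ := by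
  positivity

theorem Qsum_mono (k : ℕ) : Monotone (Qsum q k) := by
  intro m n h
  exact Finset.sum_le_sum_of_subset_of_nonneg (by simpa using h)
    fun i _ _ => Qsum_term_nonneg k i

theorem Qsum_nonneg (k n : ℕ) : 0 ≤ Qsum q k n :=
  Finset.sum_nonneg fun i _ => Qsum_term_nonneg k i

theorem Qsum_zero (k : ℕ) : Qsum q k 0 = 0 := by simp [Qsum]

theorem Qsum_zero_left (n : ℕ) : Qsum q 0 n = n := by simp [Qsum]

theorem Qsum_le_of_le (hq : ∀ n, 1 ≤ q n) {k l : ℕ} (h : k ≤ l) (n : ℕ) :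
    Qsum q l n ≤ Qsum q k n := by
  refine Finset.sum_le_sum fun j _ => ?_
  have h1 : ∀ i, (1 : ℝ) ≤ q i := fun i => by exact_mod_cast hq i
  have hpos : 0 < ∏ i ∈ Finset.range k, (q (j + i) : ℝ) :=
    Finset.prod_pos fun i _ => by linarith [h1 (j + i)]
  refine inv_anti₀ hpos ?_
  exact Finset.prod_le_prod_of_subset_of_one_le (by simpa using h)
    (fun i _ => by linarith [h1 (j + i)]) fun i _ _ => h1 _

theorem Qsum_tendsto_atTop (hdiv : FullyDivergent q) (k : ℕ) :
    Tendsto (Qsum q k) atTop atTop := by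
  rcases Nat.eq_zero_or_pos k with rfl | hk
  · simpa [funext (Qsum_zero_left (q := q))] using tendsto_natCast_atTop_atTop (R := ℝ)
  · exact hdiv k hk

theorem Qsum_succ_isLittleO (hinf : InfiniteInLimit q) (hdiv : FullyDivergent q) (k : ℕ) :
    Qsum q (k + 1) =o[atTop] Qsum q k := by
  refine Asymptotics.IsLittleO.sum_range ?_ (fun j => Qsum_term_nonneg k j)
    (Qsum_tendsto_atTop hdiv k)
  have h0 : Tendsto (fun j => ((q (j + k) : ℝ))⁻¹) atTop (𝓝 0) :=
    tendsto_inv_atTop_zero.comp (tendsto_natCast_atTop_atTop.comp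
      (hinf.comp (tendsto_add_atTop_nat k)))
  have := ((Asymptotics.isLittleO_one_iff ℝ).2 h0).mul_isBigO
    (Asymptotics.isBigO_refl (fun j => (∏ i ∈ Finset.range k, (q (j + i) : ℝ))⁻¹) atTop)
  simpa [Finset.prod_range_succ] using this

theorem Qsum_isLittleO (hq : ∀ n, 1 ≤ q n) (hinf : InfiniteInLimit q) (hdiv : FullyDivergent q)
    {k l : ℕ} (h : k < l) : Qsum q l =o[atTop] Qsum q k := by
  refine Asymptotics.IsBigO.trans_isLittleO (Asymptotics.IsBigO.of_bound 1 ?_)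
    (Qsum_succ_isLittleO hinf hdiv k)
  refine Eventually.of_forall fun n => ?_
  rw [Real.norm_of_nonneg (Qsum_nonneg _ _), Real.norm_of_nonneg (Qsum_nonneg _ _), one_mul]
  exact Qsum_le_of_le hq h n

end Qsum

/-- A slowly growing basic sequence. -/
def slowSeq (n : ℕ) : ℕ := Nat.log 2 n + 8

theorem slowSeq_mono : Monotone slowSeq := fun _ _ h =>
  Nat.add_le_add_right (Nat.log_mono_right h) 8

theorem eight_le_slowSeq (n : ℕ) : 8 ≤ slowSeq n := Nat.le_add_left _ _

theorem slowSeq_two_pow (m : ℕ) : slowSeq (2 ^ m) = m + 8 := by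
  simp [slowSeq, Nat.log_pow]

theorem slowSeq_tendsto : Tendsto slowSeq atTop atTop :=
  tendsto_atTop_atTop_of_monotone slowSeq_mono fun b =>
    ⟨2 ^ b, by rw [slowSeq_two_pow]; omega⟩

theorem slowSeq_le_half (n : ℕ) : slowSeq n ≤ slowSeq (n / 2) + 1 := by
  unfold slowSeq
  rw [Nat.log_div_base]
  omega

theorem slowSeq_succ_le (n : ℕ) : slowSeq (n + 1) ≤ slowSeq n + 1 := by
  unfold slowSeq
  rcases Nat.eq_zero_or_pos n with rfl | hn
  · simp
  · have : Nat.log 2 (n + 1) ≤ Nat.log 2 (n * 2) := Nat.log_mono_right (by omega)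
    rw [Nat.log_mul_base (by norm_num) (by omega)] at this
    omega

theorem computable_slowSeq : Computable slowSeq := by
  have hpow : Primrec₂ fun b k : ℕ => b ^ k := Primrec₂.unpaired'.1 Nat.Primrec.pow
  have hrel : PrimrecRel fun n k : ℕ => 2 ^ k ≤ n :=
    Primrec.nat_le.comp₂ (hpow.comp₂ (Primrec.const 2).to₂ Primrec₂.right) Primrec₂.left
  have hlog : Primrec fun n : ℕ => Nat.findGreatest (fun k => 2 ^ k ≤ n) n :=
    Primrec.nat_findGreatest Primrec.id hrel
  have hlog' : Primrec fun n : ℕ => Nat.log 2 n := hlog.of_eq fun n => by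
    rcases Nat.eq_zero_or_pos n with rfl | hn
    · simp
    · refine Nat.findGreatest_eq_iff.2 ⟨Nat.log_le_self 2 n, fun _ =>
        Nat.pow_log_le_self 2 hn.ne', fun m hm _ hle => ?_⟩
      exact absurd ((Nat.le_log_iff_pow_le one_lt_two hn.ne').2 hle) (not_le.2 hm)
  exact (Primrec.nat_add.comp hlog' (Primrec.const 8)).to_comp

theorem slowSeq_fullyDivergent : FullyDivergent slowSeq := by
  intro k _
  refine tendsto_atTop_of_monotone_of_subseq (Qsum_mono k) (φ := fun m => 2 ^ m)
    (l := atTop) ?_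
  have hlim : Tendsto (fun m : ℕ => (2 : ℝ) ^ (m + 9) / ((m + 9 : ℕ) : ℝ) ^ k) atTop atTop := by
    have h := (tendsto_pow_const_div_const_pow_of_one_lt k (one_lt_two (α := ℝ))).comp
      (tendsto_add_atTop_nat 9)
    have h' := Tendsto.inv_tendsto_nhdsGT_zero
      (tendsto_nhdsWithin_iff.2 ⟨h, Eventually.of_forall fun m => ?_⟩)
    · refine h'.congr fun m => ?_
      simp
    · simp only [Function.comp, Set.mem_Ioi]
      positivity
  have hlim' := hlim.atTop_div_const (r := (2 : ℝ) ^ 9) (by positivity)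
  refine tendsto_atTop_mono' _ ?_ hlim'
  filter_upwards [eventually_ge_atTop k] with m hm
  have hk : k ≤ 2 ^ m := hm.trans (Nat.lt_two_pow_self).le
  have hterm : ∀ j ∈ Finset.range (2 ^ m), (((m + 9 : ℕ) : ℝ) ^ k)⁻¹ ≤
      (∏ i ∈ Finset.range k, (slowSeq (j + i) : ℝ))⁻¹ := by
    intro j hj
    refine inv_anti₀ (Finset.prod_pos fun i _ => ?_) ?_
    · have := eight_le_slowSeq (j + i)
      positivity
    · calc ∏ i ∈ Finset.range k, (slowSeq (j + i) : ℝ)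
          ≤ ∏ _i ∈ Finset.range k, ((m + 9 : ℕ) : ℝ) := by
            refine Finset.prod_le_prod (fun i _ => by positivity) fun i hi => ?_
            have : slowSeq (j + i) ≤ slowSeq (2 ^ (m + 1)) := slowSeq_mono (by
              simp only [Finset.mem_range] at hi hj
              rw [pow_succ]; omega)
            rw [slowSeq_two_pow] at this
            exact_mod_cast this
        _ = _ := by simp
  calc (2 : ℝ) ^ (m + 9) / ((m + 9 : ℕ) : ℝ) ^ k / 2 ^ 9
      = ∑ j ∈ Finset.range (2 ^ m), (((m + 9 : ℕ) : ℝ) ^ k)⁻¹ := by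
        rw [Finset.sum_const, Finset.card_range, nsmul_eq_mul, pow_add]
        push_cast
        field_simp
    _ ≤ _ := Finset.sum_le_sum hterm

/-- The `c`-th finite word over `ℕ`. -/
def codeWord (c : ℕ) : List ℕ := Denumerable.ofNat (List ℕ) c

/-- The starting position of the `t`-th slot. -/
def slotStart (q : ℕ → ℕ) (t : ℕ) : ℕ := ∑ i ∈ Finset.range t, q i

/-- The place reserved for the `c`-th word, relative to the start of a slot. -/
def wordOffset (c : ℕ) : ℕ := ∑ i ∈ Finset.range c, ((codeWord i).length + 1)

/-- The integer part of `Q^{(k)}` increases along the `t`-th slot. -/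
def FloorJump (q : ℕ → ℕ) (k t : ℕ) : Prop :=
  ⌊Qsum q k (slotStart q t)⌋₊ < ⌊Qsum q k (slotStart q (t + 1))⌋₊

/-- The `c`-th word is written in the slot `t + 1`. -/
def Placed (q : ℕ → ℕ) (S : Set ℕ) (s : ℕ → ℕ) (c t : ℕ) : Prop :=
  (codeWord c).length ∈ S ∧ s c ≤ t ∧ FloorJump q (codeWord c).length t

/-- The position where the `c`-th word starts in the slot `t + 1`. -/
def wordPos (q : ℕ → ℕ) (c t : ℕ) : ℕ := slotStart q (t + 1) + wordOffset c

/-- The copy of the `c`-th word in the slot `t + 1` is written and covers position `n`. -/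
def Covers (q : ℕ → ℕ) (S : Set ℕ) (s : ℕ → ℕ) (c t n : ℕ) : Prop :=
  Placed q S s c t ∧ wordPos q c t ≤ n ∧ n < wordPos q c t + (codeWord c).length

/-- The prescribed digits: letters of the written words, and `none` at free positions. -/
noncomputable def forcedDigit (q : ℕ → ℕ) (S : Set ℕ) (s : ℕ → ℕ) (n : ℕ) : Option ℕ :=
  if h : ∃ p : ℕ × ℕ, Covers q S s p.1 p.2 n then
    some ((codeWord h.choose.1).getD (n - wordPos q h.choose.1 h.choose.2) 0)
  else none

/-- The slots `t + 1` starting before `n` in which the `c`-th word is written. -/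
noncomputable def placements (q : ℕ → ℕ) (S : Set ℕ) (s : ℕ → ℕ) (c n : ℕ) : Finset ℕ :=
  (Finset.range n).filter fun t => Placed q S s c t ∧ slotStart q (t + 1) < n

/-- Occurrences of a block among the prescribed digits. -/
noncomputable def forcedOccurrences (q : ℕ → ℕ) (S : Set ℕ) (s : ℕ → ℕ) {k : ℕ}
    (B : Fin k → ℕ) (n : ℕ) : Finset ℕ :=
  (Finset.range n).filter fun i => ∀ j : Fin k, forcedDigit q S s (i + (j : ℕ)) = some (B j)

section Slots

variable {q : ℕ → ℕ}

theorem slotStart_succ (t : ℕ) : slotStart q (t + 1) = slotStart q t + q t :=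
  Finset.sum_range_succ _ _

theorem slotStart_strictMono (hq : ∀ n, 1 ≤ q n) : StrictMono (slotStart q) :=
  strictMono_nat_of_lt_succ fun t => by
    rw [slotStart_succ]
    exact Nat.lt_add_of_pos_right (hq t)

theorem exists_slot (hq : ∀ n, 1 ≤ q n) (n : ℕ) : ∃ T, slotStart q T ≤ n ∧
    n ≤ slotStart q (T + 1) ∧ ∀ t, slotStart q (t + 1) < n ↔ t < T := by
  have hsm := slotStart_strictMono hq
  have hex : ∃ T, n ≤ slotStart q (T + 1) :=
    ⟨n, (Nat.le_succ n).trans hsm.le_apply⟩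
  refine ⟨Nat.find hex, ?_, Nat.find_spec hex, fun t => ⟨fun h => ?_, fun h => ?_⟩⟩
  · rcases hT : Nat.find hex with _ | u
    · simp [slotStart]
    · have := Nat.find_min hex (m := u) (by omega)
      omega
  · by_contra! hle
    have h1 := hsm.monotone (Nat.succ_le_succ hle)
    have h2 := Nat.find_spec hex
    simp only [Nat.succ_eq_add_one] at h1
    omega
  · have := Nat.find_min hex h
    omega

theorem Qsum_slot_succ_le (hq : ∀ n, 1 ≤ q n) (hmono : Monotone q) {k : ℕ} (hk : 1 ≤ k) (t : ℕ) :
    Qsum q k (slotStart q (t + 1)) ≤ Qsum q k (slotStart q t) + 1 := by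
  have h1 : ∀ i, (1 : ℝ) ≤ q i := fun i => by exact_mod_cast hq i
  have hpos : (0 : ℝ) < q t := by linarith [h1 t]
  rw [slotStart_succ, Qsum, Finset.sum_range_add]
  refine add_le_add le_rfl ?_
  calc ∑ x ∈ Finset.range (q t), (∏ i ∈ Finset.range k, (q (slotStart q t + x + i) : ℝ))⁻¹
      ≤ ∑ _x ∈ Finset.range (q t), ((q t : ℝ))⁻¹ := by
        refine Finset.sum_le_sum fun x _ => inv_anti₀ hpos ?_
        have hle : (q t : ℝ) ≤ q (slotStart q t + x + 0) := by
          exact_mod_cast hmono (by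
            have := (slotStart_strictMono hq).le_apply (x := t)
            omega)
        refine hle.trans ?_
        have := Finset.prod_le_prod_of_subset_of_one_le (s := {0}) (t := Finset.range k)
          (f := fun i => (q (slotStart q t + x + i) : ℝ)) (by simp; omega)
          (fun i _ => by linarith [h1 (slotStart q t + x + i)]) fun i _ _ => h1 _
        simpa using this
    _ = 1 := by
        rw [Finset.sum_const, Finset.card_range, nsmul_eq_mul, mul_inv_cancel₀ hpos.ne']

theorem card_floorJump_le (k T : ℕ) :
    ((Finset.range T).filter fun t => FloorJump q k t).card ≤ ⌊Qsum q k (slotStart q T)⌋₊ := by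
  induction T with
  | zero => simp
  | succ T ih =>
    rw [Finset.range_add_one, Finset.filter_insert]
    have hmono : ⌊Qsum q k (slotStart q T)⌋₊ ≤ ⌊Qsum q k (slotStart q (T + 1))⌋₊ :=
      Nat.floor_mono (Qsum_mono k (by rw [slotStart_succ]; omega))
    split_ifs with h
    · rw [Finset.card_insert_of_notMem (by simp)]
      unfold FloorJump at h
      omega
    · omega

theorem le_card_floorJump (hq : ∀ n, 1 ≤ q n) (hmono : Monotone q) {k : ℕ} (hk : 1 ≤ k)
    (s T : ℕ) : ⌊Qsum q k (slotStart q T)⌋₊ ≤ ⌊Qsum q k (slotStart q s)⌋₊ +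
      ((Finset.range T).filter fun t => s ≤ t ∧ FloorJump q k t).card := by
  induction T with
  | zero => simp [slotStart, Qsum_zero]
  | succ T ih =>
    rcases Nat.lt_or_ge T s with hT | hT
    · exact (Nat.floor_mono (Qsum_mono k
        ((slotStart_strictMono hq).monotone hT))).trans (Nat.le_add_right _ _)
    · rw [Finset.range_add_one, Finset.filter_insert]
      have hstep : ⌊Qsum q k (slotStart q (T + 1))⌋₊ ≤ ⌊Qsum q k (slotStart q T)⌋₊ + 1 := by
        rw [← Nat.floor_add_one (Qsum_nonneg _ _)]
        exact Nat.floor_mono (Qsum_slot_succ_le hq hmono hk T)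
      split_ifs with h
      · rw [Finset.card_insert_of_notMem (by simp)]
        omega
      · have : ¬ FloorJump q k T := fun hj => h ⟨hT, hj⟩
        unfold FloorJump at this
        omega

end Slots

section Placements

variable {q : ℕ → ℕ} {S : Set ℕ} {s : ℕ → ℕ}

theorem card_placements_le (hq : ∀ n, 1 ≤ q n) (c n : ℕ) :
    ((placements q S s c n).card : ℝ) ≤ Qsum q (codeWord c).length n := by
  obtain ⟨T, hT, -, hiff⟩ := exists_slot hq n
  have hsub : placements q S s c n ⊆
      (Finset.range T).filter fun t => FloorJump q (codeWord c).length t := by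
    intro t ht
    simp only [placements, Finset.mem_filter, Finset.mem_range] at ht ⊢
    exact ⟨(hiff t).1 ht.2.2, ht.2.1.2.2⟩
  calc ((placements q S s c n).card : ℝ)
      ≤ (⌊Qsum q (codeWord c).length (slotStart q T)⌋₊ : ℝ) := by
        exact_mod_cast (Finset.card_le_card hsub).trans (card_floorJump_le _ _)
    _ ≤ Qsum q (codeWord c).length (slotStart q T) := Nat.floor_le (Qsum_nonneg _ _)
    _ ≤ _ := Qsum_mono _ hT

theorem le_card_placements (hq : ∀ n, 1 ≤ q n) (hmono : Monotone q) {c : ℕ}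
    (hc : (codeWord c).length ∈ S) (hpos : 1 ≤ (codeWord c).length) (n : ℕ) :
    Qsum q (codeWord c).length n ≤ (placements q S s c n).card +
      (Qsum q (codeWord c).length (slotStart q (s c)) + 2) := by
  obtain ⟨T, -, hT, hiff⟩ := exists_slot hq n
  have hsub : ((Finset.range T).filter fun t => s c ≤ t ∧ FloorJump q (codeWord c).length t) ⊆
      placements q S s c n := by
    intro t ht
    simp only [placements, Finset.mem_filter, Finset.mem_range] at ht ⊢
    have hlt := (hiff t).2 ht.1
    have := (slotStart_strictMono hq).le_apply (x := t + 1)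
    exact ⟨by omega, ⟨hc, ht.2⟩, hlt⟩
  have h1 := (le_card_floorJump hq hmono hpos (s c) T).trans
    (Nat.add_le_add_left (Finset.card_le_card hsub) _)
  have h1' : (⌊Qsum q (codeWord c).length (slotStart q T)⌋₊ : ℝ) ≤
      ⌊Qsum q (codeWord c).length (slotStart q (s c))⌋₊ + (placements q S s c n).card := by
    exact_mod_cast h1
  have h2 := Nat.lt_floor_add_one (Qsum q (codeWord c).length (slotStart q T))
  have h3 := Nat.floor_le (Qsum_nonneg (q := q) (codeWord c).length (slotStart q (s c)))
  have h4 := Qsum_slot_succ_le hq hmono hpos T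
  have h5 := Qsum_mono (q := q) (codeWord c).length hT
  linarith

theorem placements_eq_empty {c n : ℕ} (h : n ≤ s c) :
    placements q S s c n = ∅ := by
  refine Finset.filter_eq_empty_iff.2 fun t ht hp => ?_
  have := (Finset.mem_range.1 ht)
  have := hp.1.2.1
  omega

theorem wordOffset_succ (c : ℕ) : wordOffset (c + 1) = wordOffset c + (codeWord c).length + 1 :=
  Finset.sum_range_succ _ _

theorem wordOffset_mono : Monotone wordOffset :=
  monotone_nat_of_le_succ fun c => by rw [wordOffset_succ]; omega

theorem le_wordOffset (c : ℕ) : c ≤ wordOffset c := by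
  induction c with
  | zero => simp
  | succ c ih => rw [wordOffset_succ]; omega

theorem Covers.unique (hq : ∀ n, 1 ≤ q n) (hmono : Monotone q)
    (hs : ∀ c, wordOffset (c + 1) ≤ q (s c)) {c t n c' t' n' : ℕ} (h : Covers q S s c t n)
    (h' : Covers q S s c' t' n') (hn : n ≤ n') (hn' : n' ≤ n + 1) : c = c' ∧ t = t' := by
  obtain ⟨⟨-, hst, -⟩, h1, h2⟩ := h
  obtain ⟨⟨-, hst', -⟩, h1', h2'⟩ := h'
  have key : ∀ {c t t' : ℕ}, s c ≤ t → t < t' →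
      slotStart q (t + 1) + wordOffset (c + 1) ≤ slotStart q (t' + 1) := by
    intro c t t' hst htt
    have h1 := (slotStart_strictMono hq).monotone (Nat.succ_le_succ (Nat.succ_le_of_lt htt))
    have h2 := slotStart_succ (q := q) (t + 1)
    have h3 := (hs c).trans (hmono (hst.trans (Nat.le_succ t)))
    simp only [Nat.succ_eq_add_one] at h1 h3
    omega
  unfold wordPos at *
  have e := wordOffset_succ c
  have e' := wordOffset_succ c'
  rcases lt_trichotomy t t' with ht | rfl | ht
  · have := key hst ht
    omega
  · rcases lt_trichotomy c c' with hc | rfl | hc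
    · have := wordOffset_mono (Nat.succ_le_of_lt hc)
      simp only [Nat.succ_eq_add_one] at this
      omega
    · exact ⟨rfl, rfl⟩
    · have := wordOffset_mono (Nat.succ_le_of_lt hc)
      simp only [Nat.succ_eq_add_one] at this
      omega
  · have := key hst' ht
    omega

theorem Covers.forcedDigit_eq (hq : ∀ n, 1 ≤ q n) (hmono : Monotone q)
    (hs : ∀ c, wordOffset (c + 1) ≤ q (s c)) {c t n : ℕ} (h : Covers q S s c t n) :
    forcedDigit q S s n = some ((codeWord c).getD (n - wordPos q c t) 0) := by
  have hex : ∃ p : ℕ × ℕ, Covers q S s p.1 p.2 n := ⟨(c, t), h⟩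
  obtain ⟨h1, h2⟩ := hex.choose_spec.unique hq hmono hs h le_rfl (Nat.le_succ n)
  rw [forcedDigit, dif_pos hex, h1, h2]

theorem exists_covers_of_forcedDigit_eq_some (hq : ∀ n, 1 ≤ q n) (hmono : Monotone q)
    (hs : ∀ c, wordOffset (c + 1) ≤ q (s c)) {n e : ℕ} (h : forcedDigit q S s n = some e) :
    ∃ c t, Covers q S s c t n ∧ (codeWord c).getD (n - wordPos q c t) 0 = e := by
  by_cases hex : ∃ p : ℕ × ℕ, Covers q S s p.1 p.2 n
  · obtain ⟨⟨c, t⟩, hc⟩ := hex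
    refine ⟨c, t, hc, ?_⟩
    rw [hc.forcedDigit_eq hq hmono hs] at h
    exact Option.some.inj h
  · rw [forcedDigit, dif_neg hex] at h
    cases h

theorem forcedDigit_lt (hq : ∀ n, 1 ≤ q n) (hmono : Monotone q)
    (hs : ∀ c, wordOffset (c + 1) ≤ q (s c)) (hs' : ∀ c, ∀ e ∈ codeWord c, 2 * e + 2 ≤ q (s c))
    {n e : ℕ} (h : forcedDigit q S s n = some e) : 2 * e + 2 ≤ q n := by
  obtain ⟨c, t, ⟨⟨-, hst, -⟩, h1, h2⟩, rfl⟩ := exists_covers_of_forcedDigit_eq_some hq hmono hs h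
  have hlt : n - wordPos q c t < (codeWord c).length := by omega
  rw [List.getD_eq_getElem _ _ hlt]
  refine (hs' c _ (List.getElem_mem hlt)).trans (hmono ?_)
  have := (slotStart_strictMono hq).le_apply (x := t + 1)
  unfold wordPos at h1
  omega

theorem exists_word_of_mem_forcedOccurrences (hq : ∀ n, 1 ≤ q n) (hmono : Monotone q)
    (hs : ∀ c, wordOffset (c + 1) ≤ q (s c)) {k : ℕ} (hk : 1 ≤ k) {B : Fin k → ℕ} {i : ℕ}
    (h : ∀ j : Fin k, forcedDigit q S s (i + (j : ℕ)) = some (B j)) :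
    ∃ c t, Placed q S s c t ∧ wordPos q c t ≤ i ∧
      i + k ≤ wordPos q c t + (codeWord c).length ∧
      ∀ j : Fin k, (codeWord c).getD (i + j - wordPos q c t) 0 = B j := by
  obtain ⟨c, t, hct, -⟩ := exists_covers_of_forcedDigit_eq_some hq hmono hs (h ⟨0, hk⟩)
  simp only [add_zero] at hct
  have hcov : ∀ j, j < k → Covers q S s c t (i + j) := by
    intro j
    induction j with
    | zero => exact fun _ => hct
    | succ j ih =>
      intro hj
      obtain ⟨c', t', hct', -⟩ := exists_covers_of_forcedDigit_eq_some hq hmono hs (h ⟨j + 1, hj⟩)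
      obtain ⟨rfl, rfl⟩ := (ih (by omega)).unique hq hmono hs hct' (by simp) (by simp; omega)
      exact hct'
  refine ⟨c, t, hct.1, hct.2.1, ?_, fun j => ?_⟩
  · have := (hcov (k - 1) (by omega)).2.2
    omega
  · have := (hcov j j.2).forcedDigit_eq hq hmono hs
    rw [h j] at this
    exact (Option.some.inj this).symm

end Placements

/-- Upper bound for the number of positions before `n` covered by written words of length
greater than `k`. -/
noncomputable def longWordMass (q : ℕ → ℕ) (S : Set ℕ) (s : ℕ → ℕ) (k n : ℕ) : ℕ :=
  ∑ c ∈ (Finset.range n).filter fun c => k < (codeWord c).length,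
    (codeWord c).length * (placements q S s c n).card

section Counting

variable {q : ℕ → ℕ} {S : Set ℕ} {s : ℕ → ℕ}

theorem card_covered_le (k n : ℕ) :
    (((Finset.range n).filter fun c => k < (codeWord c).length).biUnion fun c =>
      (placements q S s c n).biUnion fun t =>
        Finset.Ico (wordPos q c t) (wordPos q c t + (codeWord c).length)).card ≤
      longWordMass q S s k n := by
  refine Finset.card_biUnion_le.trans (Finset.sum_le_sum fun c _ => ?_)
  refine Finset.card_biUnion_le.trans ?_
  simp [mul_comm]

theorem mem_covered {c t i k n : ℕ} (hc : Placed q S s c t) (hk : k < (codeWord c).length)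
    (h1 : wordPos q c t ≤ i) (h2 : i < wordPos q c t + (codeWord c).length) (hi : i < n)
    (hq : ∀ n, 1 ≤ q n) :
    i ∈ (((Finset.range n).filter fun c => k < (codeWord c).length).biUnion fun c =>
      (placements q S s c n).biUnion fun t =>
        Finset.Ico (wordPos q c t) (wordPos q c t + (codeWord c).length)) := by
  have h3 := le_wordOffset c
  have h4 := (slotStart_strictMono hq).le_apply (x := t + 1)
  unfold wordPos at h1 h2
  simp only [Finset.mem_biUnion, Finset.mem_filter, Finset.mem_range, Finset.mem_Ico, placements,
    wordPos]
  exact ⟨c, ⟨by omega, hk⟩, t, ⟨by omega, hc, by omega⟩, h1, h2⟩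

theorem card_forced_le (hq : ∀ n, 1 ≤ q n) (hmono : Monotone q)
    (hs : ∀ c, wordOffset (c + 1) ≤ q (s c)) (n : ℕ) :
    ((Finset.range n).filter fun i => forcedDigit q S s i ≠ none).card ≤
      longWordMass q S s 0 n := by
  refine (Finset.card_le_card fun i hi => ?_).trans (card_covered_le 0 n)
  simp only [Finset.mem_filter, Finset.mem_range] at hi
  obtain ⟨e, he⟩ := Option.ne_none_iff_exists'.1 hi.2
  obtain ⟨c, t, ⟨hp, h1, h2⟩, -⟩ := exists_covers_of_forcedDigit_eq_some hq hmono hs he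
  exact mem_covered hp (by omega) h1 h2 hi.1 hq

theorem codeWord_encode {k : ℕ} (B : Fin k → ℕ) :
    codeWord (Encodable.encode (List.ofFn B)) = List.ofFn B := Denumerable.ofNat_encode _

theorem card_forcedOccurrences_le (hq : ∀ n, 1 ≤ q n) (hmono : Monotone q)
    (hs : ∀ c, wordOffset (c + 1) ≤ q (s c)) {k : ℕ} (hk : 1 ≤ k) (B : Fin k → ℕ) (n : ℕ) :
    (forcedOccurrences q S s B n).card ≤
      (placements q S s (Encodable.encode (List.ofFn B)) n).card + longWordMass q S s k n := by
  refine (Finset.card_le_card (t := (placements q S s (Encodable.encode (List.ofFn B)) n).image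
    (wordPos q (Encodable.encode (List.ofFn B))) ∪ _) fun i hi => ?_).trans
    ((Finset.card_union_le _ _).trans (Nat.add_le_add Finset.card_image_le (card_covered_le k n)))
  simp only [forcedOccurrences, Finset.mem_filter, Finset.mem_range] at hi
  obtain ⟨c, t, hp, h1, h2, h3⟩ := exists_word_of_mem_forcedOccurrences hq hmono hs hk hi.2
  rw [Finset.mem_union]
  rcases (show k ≤ (codeWord c).length by omega).eq_or_lt with hlen | hlen
  · left
    have hi' : i = wordPos q c t := by omega
    have hc : c = Encodable.encode (List.ofFn B) := by
      have : codeWord c = List.ofFn B := by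
        refine List.ext_getElem (by simp [hlen]) fun j hj hj' => ?_
        have := h3 ⟨j, by omega⟩
        rw [hi', Nat.add_sub_cancel_left, List.getD_eq_getElem _ _ hj] at this
        simp [this]
      rw [← this, codeWord, Denumerable.encode_ofNat]
    subst hc
    refine Finset.mem_image.2 ⟨t, ?_, hi'.symm⟩
    have h4 := (slotStart_strictMono hq).le_apply (x := t + 1)
    unfold wordPos at h1
    simp only [placements, Finset.mem_filter, Finset.mem_range]
    exact ⟨by omega, hp, by omega⟩
  · right
    exact mem_covered hp hlen h1 (by omega) hi.1 hq

theorem card_placements_le_forcedOccurrences (hq : ∀ n, 1 ≤ q n) (hmono : Monotone q)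
    (hs : ∀ c, wordOffset (c + 1) ≤ q (s c)) {k : ℕ} (B : Fin k → ℕ) (n : ℕ) :
    (placements q S s (Encodable.encode (List.ofFn B)) n).card ≤
      (forcedOccurrences q S s B n).card + wordOffset (Encodable.encode (List.ofFn B)) := by
  set c := Encodable.encode (List.ofFn B) with hc
  have hinj : Function.Injective fun t => slotStart q (t + 1) :=
    (slotStart_strictMono hq).injective.comp (add_left_injective 1)
  rw [← Finset.card_filter_add_card_filter_not (s := placements q S s c n)
    (fun t => wordPos q c t < n)]
  refine Nat.add_le_add ?_ ?_
  · refine Finset.card_le_card_of_injOn (wordPos q c) (fun t ht => ?_) ?_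
    · simp only [placements, Finset.mem_coe, Finset.mem_filter, Finset.mem_range] at ht
      simp only [forcedOccurrences, Finset.mem_coe, Finset.mem_filter, Finset.mem_range]
      refine ⟨ht.2, fun j => ?_⟩
      have hlen : (codeWord c).length = k := by rw [hc, codeWord_encode, List.length_ofFn]
      have hcov : Covers q S s c t (wordPos q c t + j) :=
        ⟨ht.1.2.1, Nat.le_add_right _ _, by rw [hlen]; exact Nat.add_lt_add_left j.2 _⟩
      rw [hcov.forcedDigit_eq hq hmono hs, Nat.add_sub_cancel_left, hc, codeWord_encode,
        List.getD_eq_getElem _ _ (by simp)]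
      simp
    · exact fun t _ t' _ h => hinj (Nat.add_right_cancel h)
  · refine (Finset.card_le_card_of_injOn (t := Finset.Ico (n - wordOffset c) n)
      (fun t => slotStart q (t + 1)) (fun t ht => ?_) hinj.injOn).trans
      (by rw [Nat.card_Ico]; omega)
    obtain ⟨ht, hpos⟩ := Finset.mem_filter.1 ht
    have hlt := (Finset.mem_filter.1 ht).2.2
    simp only [Finset.coe_Ico, Set.mem_Ico]
    unfold wordPos at hpos
    omega

/-- The start times `s` are late enough for the long words to be negligible. -/
def Sparse (q s : ℕ → ℕ) : Prop :=
  ∀ c k n, k < (codeWord c).length → s c ≤ n →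
    ((codeWord c).length : ℝ) * Qsum q (codeWord c).length n ≤ (1 / 2) ^ c * Qsum q k n

theorem longWordMass_isLittleO (hq : ∀ n, 1 ≤ q n) (hinf : InfiniteInLimit q)
    (hdiv : FullyDivergent q) (hsp : Sparse q s) (k : ℕ) :
    (fun n => (longWordMass q S s k n : ℝ)) =o[atTop] Qsum q k := by
  have hQ := Qsum_tendsto_atTop hdiv k
  have hQpos : ∀ᶠ n in atTop, 0 < Qsum q k n := hQ.eventually_gt_atTop 0
  refine (Asymptotics.isLittleO_iff_tendsto' ?_).2 ?_
  · filter_upwards [hQpos] with n hn h0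
    exact absurd h0 hn.ne'
  let F : ℕ → ℕ → ℝ := fun n c => if k < (codeWord c).length then
    ((codeWord c).length : ℝ) * (placements q S s c n).card / Qsum q k n else 0
  have hF0 : ∀ n c, 0 ≤ F n c := fun n c => by
    have := Qsum_nonneg (q := q) k n
    simp only [F]
    split_ifs <;> positivity
  have hbound : ∀ᶠ n in atTop, ∀ c, ‖F n c‖ ≤ (1 / 2 : ℝ) ^ c := by
    filter_upwards [hQpos] with n hn c
    rw [Real.norm_of_nonneg (hF0 n c)]
    simp only [F]
    split_ifs with hlen
    · rw [div_le_iff₀ hn]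
      rcases Nat.lt_or_ge n (s c) with hlt | hge
      · rw [placements_eq_empty hlt.le]
        simp only [Finset.card_empty, Nat.cast_zero, mul_zero]
        positivity
      · refine le_trans ?_ (hsp c k n hlen hge)
        exact mul_le_mul_of_nonneg_left (card_placements_le hq c n) (Nat.cast_nonneg _)
    · positivity
  have hlim : ∀ c, Tendsto (fun n => F n c) atTop (𝓝 0) := by
    intro c
    by_cases hlen : k < (codeWord c).length
    · have h1 : (fun n => ((codeWord c).length : ℝ) * Qsum q (codeWord c).length n) =o[atTop]
          Qsum q k := (Qsum_isLittleO hq hinf hdiv hlen).const_mul_left _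
      refine squeeze_zero (hF0 · c) (fun n => ?_) h1.tendsto_div_nhds_zero
      simp only [F, if_pos hlen]
      refine div_le_div_of_nonneg_right ?_ (Qsum_nonneg _ _)
      exact mul_le_mul_of_nonneg_left (card_placements_le hq c n) (Nat.cast_nonneg _)
    · simp [F, hlen]
  have hsum : Summable fun c : ℕ => (1 / 2 : ℝ) ^ c := summable_geometric_two
  have htsum := tendsto_tsum_of_dominated_convergence hsum hlim hbound
  rw [tsum_zero] at htsum
  refine squeeze_zero' (Eventually.of_forall fun n => ?_) ?_ htsum
  · have := Qsum_nonneg (q := q) k n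
    positivity
  · filter_upwards [hbound] with n hn
    have hsF : Summable (F n) := Summable.of_norm_bounded hsum hn
    refine le_trans (le_of_eq ?_) (hsF.sum_le_tsum (Finset.range n) fun c _ => hF0 n c)
    simp only [F, longWordMass, ← Finset.sum_filter]
    push_cast
    rw [Finset.sum_div]

theorem forcedOccurrences_tendsto (hq : ∀ n, 1 ≤ q n) (hmono : Monotone q)
    (hinf : InfiniteInLimit q) (hdiv : FullyDivergent q)
    (hs : ∀ c, wordOffset (c + 1) ≤ q (s c)) (hsp : Sparse q s) {k : ℕ} (hk : 1 ≤ k)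
    (B : Fin k → ℕ) :
    Tendsto (fun n => ((forcedOccurrences q S s B n).card : ℝ) / Qsum q k n) atTop
      (𝓝 (if k ∈ S then 1 else 0)) := by
  have hQ := Qsum_tendsto_atTop hdiv k
  have hQpos : ∀ᶠ n in atTop, 0 < Qsum q k n := hQ.eventually_gt_atTop 0
  have hmass := (longWordMass_isLittleO (S := S) hq hinf hdiv hsp k).tendsto_div_nhds_zero
  set c := Encodable.encode (List.ofFn B) with hc
  have hlen : (codeWord c).length = k := by rw [hc, codeWord_encode, List.length_ofFn]
  split_ifs with hkS
  · have hlow : Tendsto (fun n => 1 - (Qsum q k (slotStart q (s c)) + 2 + wordOffset c) /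
        Qsum q k n) atTop (𝓝 (1 - 0)) :=
      tendsto_const_nhds.sub (hQ.const_div_atTop _)
    have hup : Tendsto (fun n => 1 + (longWordMass q S s k n : ℝ) / Qsum q k n) atTop
        (𝓝 (1 + 0)) := tendsto_const_nhds.add hmass
    rw [sub_zero] at hlow
    rw [add_zero] at hup
    refine tendsto_of_tendsto_of_tendsto_of_le_of_le' hlow hup ?_ ?_
    · filter_upwards [hQpos] with n hn
      rw [sub_le_iff_le_add, ← add_div, le_div_iff₀ hn, one_mul]
      have h1 := le_card_placements (S := S) (s := s) hq hmono (c := c) (by rwa [hlen])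
        (by rwa [hlen]) n
      have h2 : ((placements q S s c n).card : ℝ) ≤
          (forcedOccurrences q S s B n).card + wordOffset c := by
        exact_mod_cast card_placements_le_forcedOccurrences hq hmono hs B n
      rw [hlen] at h1
      linarith
    · filter_upwards [hQpos] with n hn
      rw [div_le_iff₀ hn, add_mul, div_mul_cancel₀ _ hn.ne', one_mul]
      have h1 := card_placements_le (S := S) (s := s) hq c n
      have h2 : ((forcedOccurrences q S s B n).card : ℝ) ≤
          (placements q S s c n).card + longWordMass q S s k n := by
        exact_mod_cast card_forcedOccurrences_le hq hmono hs hk B n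
      rw [hlen] at h1
      linarith
  · refine squeeze_zero (fun n => div_nonneg (Nat.cast_nonneg _) (Qsum_nonneg _ _))
      (fun n => ?_) hmass
    refine div_le_div_of_nonneg_right ?_ (Qsum_nonneg _ _)
    have h1 := card_forcedOccurrences_le (S := S) (s := s) hq hmono hs hk B n
    have h2 : placements q S s c n = ∅ :=
      Finset.filter_eq_empty_iff.2 fun t _ hp => hkS (hlen ▸ hp.1.1)
    rw [← hc, h2, Finset.card_empty, zero_add] at h1
    exact_mod_cast h1

theorem exists_startTimes (hq : ∀ n, 1 ≤ q n) (hinf : InfiniteInLimit q)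
    (hdiv : FullyDivergent q) : ∃ s : ℕ → ℕ, (∀ c, wordOffset (c + 1) ≤ q (s c)) ∧
      (∀ c, ∀ e ∈ codeWord c, 2 * e + 2 ≤ q (s c)) ∧ Sparse q s := by
  have hex : ∀ c, ∃ N, wordOffset (c + 1) ≤ q N ∧ (∀ e ∈ codeWord c, 2 * e + 2 ≤ q N) ∧
      ∀ k n, k < (codeWord c).length → N ≤ n →
        ((codeWord c).length : ℝ) * Qsum q (codeWord c).length n ≤
          (1 / 2) ^ c * Qsum q k n := by
    intro c
    have h1 : ∀ᶠ N in atTop, wordOffset (c + 1) ≤ q N := hinf.eventually_ge_atTop _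
    have h2 : ∀ᶠ N in atTop, ∀ e ∈ codeWord c, 2 * e + 2 ≤ q N := by
      filter_upwards [hinf.eventually_ge_atTop (2 * (codeWord c).sum + 2)] with N hN e he
      have := List.le_sum_of_mem he
      omega
    have h3 : ∀ᶠ n in atTop, ∀ k ∈ Finset.range (codeWord c).length,
        ((codeWord c).length : ℝ) * Qsum q (codeWord c).length n ≤
          (1 / 2) ^ c * Qsum q k n := by
      refine (Filter.eventually_all_finset _).2 fun k hk => ?_
      have := ((Qsum_isLittleO hq hinf hdiv (Finset.mem_range.1 hk)).const_mul_left
        ((codeWord c).length : ℝ)).bound (c := (1 / 2) ^ c) (by positivity)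
      filter_upwards [this] with n hn
      rwa [Real.norm_of_nonneg (Qsum_nonneg _ _), Real.norm_of_nonneg
        (mul_nonneg (Nat.cast_nonneg _) (Qsum_nonneg _ _))] at hn
    obtain ⟨N, hN⟩ := eventually_atTop.1 (h1.and (h2.and h3))
    exact ⟨N, (hN N le_rfl).1, (hN N le_rfl).2.1, fun k n hk hn =>
      (hN n hn).2.2 k (Finset.mem_range.2 hk)⟩
  choose s h1 h2 h3 using hex
  exact ⟨s, h1, h2, h3⟩

end Counting

/-- The number in `[0, 1]` with Cantor series digits `E n, E (n + 1), …` with respect to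
`q n, q (n + 1), …`. -/
noncomputable def cantorTail (q E : ℕ → ℕ) (n : ℕ) : ℝ :=
  ∑' m : ℕ, (E (n + m) : ℝ) / ∏ i ∈ Finset.range (m + 1), (q (n + i) : ℝ)

section CantorSeries

variable {q E E' : ℕ → ℕ}

theorem qprod_succ (n : ℕ) : qprod q (n + 1) = qprod q n * q n := Finset.prod_range_succ _ _

theorem qprod_pos (hq : ∀ n, 1 ≤ q n) (n : ℕ) : 0 < qprod q n :=
  Finset.prod_pos fun i _ => by exact_mod_cast hq i

theorem pos_of_digit_bound (hE : ∀ n, E n + 2 ≤ q n) (n : ℕ) : (0 : ℝ) < q n := by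
  exact_mod_cast (by have := hE n; omega : 0 < q n)

theorem cantorTail_partial_sum_le (hE : ∀ n, E n + 2 ≤ q n) (n N : ℕ) :
    ∑ m ∈ Finset.range N, (E (n + m) : ℝ) / ∏ i ∈ Finset.range (m + 1), (q (n + i) : ℝ) ≤
      1 - (∏ i ∈ Finset.range N, (q (n + i) : ℝ))⁻¹ := by
  induction N with
  | zero => simp
  | succ N ih =>
    have hP : 0 < ∏ i ∈ Finset.range N, (q (n + i) : ℝ) :=
      Finset.prod_pos fun i _ => pos_of_digit_bound hE _
    have hqN := pos_of_digit_bound hE (n + N)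
    have hEN : (E (n + N) : ℝ) + 2 ≤ q (n + N) := by exact_mod_cast hE (n + N)
    rw [Finset.sum_range_succ, Finset.prod_range_succ]
    set P := ∏ i ∈ Finset.range N, (q (n + i) : ℝ)
    have : (E (n + N) : ℝ) / (P * q (n + N)) ≤ P⁻¹ - (P * q (n + N))⁻¹ := by
      rw [div_le_iff₀ (by positivity)]
      field_simp
      linarith
    linarith

theorem cantorTail_summable (hE : ∀ n, E n + 2 ≤ q n) (n : ℕ) :
    Summable fun m : ℕ => (E (n + m) : ℝ) / ∏ i ∈ Finset.range (m + 1), (q (n + i) : ℝ) := by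
  refine summable_of_sum_range_le (c := 1) (fun m => by positivity) fun N => ?_
  refine (cantorTail_partial_sum_le hE n N).trans (sub_le_self _ (by positivity))

theorem cantorTail_nonneg (n : ℕ) : 0 ≤ cantorTail q E n :=
  tsum_nonneg fun m => by positivity

theorem cantorTail_le_one (hE : ∀ n, E n + 2 ≤ q n) (n : ℕ) : cantorTail q E n ≤ 1 :=
  Real.tsum_le_of_sum_range_le (fun m => by positivity) fun N =>
    (cantorTail_partial_sum_le hE n N).trans (sub_le_self _ (by positivity))

theorem mul_cantorTail (hE : ∀ n, E n + 2 ≤ q n) (n : ℕ) :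
    q n * cantorTail q E n = E n + cantorTail q E (n + 1) := by
  have hqn := pos_of_digit_bound hE n
  rw [cantorTail, (cantorTail_summable hE n).tsum_eq_zero_add, mul_add, ← tsum_mul_left]
  congr 1
  · simp [mul_div_cancel₀ _ hqn.ne']
  · refine tsum_congr fun m => ?_
    have e : ∏ i ∈ Finset.range (m + 1 + 1), (q (n + i) : ℝ) =
        (∏ i ∈ Finset.range (m + 1), (q (n + 1 + i) : ℝ)) * q n := by
      rw [Finset.prod_range_succ']
      exact congrArg₂ _ (Finset.prod_congr rfl fun i _ => by rw [add_assoc, add_comm 1 i]) rfl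
    have hP : 0 < ∏ i ∈ Finset.range (m + 1), (q (n + 1 + i) : ℝ) :=
      Finset.prod_pos fun i _ => pos_of_digit_bound hE _
    rw [e, show n + (m + 1) = n + 1 + m by omega]
    field_simp

theorem cantorTail_le (hE : ∀ n, E n + 2 ≤ q n) (n : ℕ) :
    cantorTail q E n ≤ 1 - (q n : ℝ)⁻¹ := by
  have hqn := pos_of_digit_bound hE n
  have h1 := mul_cantorTail hE n
  have h2 := cantorTail_le_one hE (n + 1)
  have h3 : (E n : ℝ) + 2 ≤ q n := by exact_mod_cast hE n
  rw [← mul_le_mul_iff_right₀ hqn, h1, mul_sub, mul_inv_cancel₀ hqn.ne']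
  linarith

theorem cantorTail_lt_one (hE : ∀ n, E n + 2 ≤ q n) (n : ℕ) : cantorTail q E n < 1 :=
  (cantorTail_le hE n).trans_lt (sub_lt_self _ (inv_pos.2 (pos_of_digit_bound hE n)))

theorem TQ_cantorTail (hE : ∀ n, E n + 2 ≤ q n) (n : ℕ) :
    TQ q n (cantorTail q E 0) = cantorTail q E n := by
  have h : ∃ z : ℕ, qprod q n * cantorTail q E 0 = z + cantorTail q E n := by
    induction n with
    | zero => exact ⟨0, by simp [qprod]⟩
    | succ n ih =>
      obtain ⟨z, hz⟩ := ih
      refine ⟨q n * z + E n, ?_⟩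
      rw [qprod_succ, mul_right_comm, hz, add_mul, mul_comm _ (q n : ℝ), mul_comm _ (q n : ℝ),
        mul_cantorTail hE]
      push_cast
      ring
  obtain ⟨z, hz⟩ := h
  rw [TQ, hz, Int.fract_natCast_add]
  exact Int.fract_eq_self.2 ⟨cantorTail_nonneg n, cantorTail_lt_one hE n⟩

theorem qdigit_cantorTail (hE : ∀ n, E n + 2 ≤ q n) (n : ℕ) :
    qdigit q (cantorTail q E 0) n = E n := by
  rw [qdigit, TQ_cantorTail hE, mul_cantorTail hE, add_comm,
    Nat.floor_add_natCast (cantorTail_nonneg _), Nat.floor_eq_zero.2 (cantorTail_lt_one hE _),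
    zero_add]

theorem inv_qprod_le_abs_cantorTail_sub (hE : ∀ n, E n + 2 ≤ q n) (hE' : ∀ n, E' n + 2 ≤ q n)
    {n : ℕ} (hlt : ∀ i < n, E i = E' i) (hn : E n ≠ E' n) :
    (qprod q (n + 2))⁻¹ ≤ |cantorTail q E 0 - cantorTail q E' 0| := by
  have hdiff : ∀ m, (∀ i < m, E i = E' i) → qprod q m * (cantorTail q E 0 - cantorTail q E' 0) =
      cantorTail q E m - cantorTail q E' m := by
    intro m
    induction m with
    | zero => simp [qprod]
    | succ m ih =>
      intro h
      rw [qprod_succ, mul_right_comm, ih fun i hi => h i (by omega), mul_comm, mul_sub,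
        mul_cantorTail hE, mul_cantorTail hE', h m (by omega)]
      ring
  have hqpos : ∀ m, 0 < qprod q m := qprod_pos fun m => by have := hE m; omega
  have h1 : qprod q (n + 1) * (cantorTail q E 0 - cantorTail q E' 0) =
      (E n - E' n : ℝ) + (cantorTail q E (n + 1) - cantorTail q E' (n + 1)) := by
    rw [qprod_succ, mul_right_comm, hdiff n hlt, mul_comm, mul_sub, mul_cantorTail hE,
      mul_cantorTail hE']
    ring
  have h2 : (1 : ℝ) ≤ |(E n : ℝ) - E' n| := by
    have : (1 : ℤ) ≤ |(E n : ℤ) - E' n| := Int.one_le_abs (sub_ne_zero.2 (by exact_mod_cast hn))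
    exact_mod_cast this
  have h3 : |cantorTail q E (n + 1) - cantorTail q E' (n + 1)| ≤ 1 - (q (n + 1) : ℝ)⁻¹ := by
    have a1 := cantorTail_le hE (n + 1)
    have a2 := cantorTail_le hE' (n + 1)
    have a3 := cantorTail_nonneg (q := q) (E := E) (n + 1)
    have a4 := cantorTail_nonneg (q := q) (E := E') (n + 1)
    rw [abs_le]
    constructor <;> linarith
  have h4 : (q (n + 1) : ℝ)⁻¹ ≤
      qprod q (n + 1) * |cantorTail q E 0 - cantorTail q E' 0| := by
    rw [← abs_of_pos (hqpos (n + 1)), ← abs_mul, h1]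
    have := abs_sub_abs_le_abs_add ((E n : ℝ) - E' n)
      (cantorTail q E (n + 1) - cantorTail q E' (n + 1))
    linarith
  rw [qprod_succ (n + 1), mul_inv, inv_mul_le_iff₀ (hqpos (n + 1))]
  exact h4

end CantorSeries

section Digits

variable {a : ℕ → ℕ}

theorem TQ_nonneg (y : ℝ) (n : ℕ) : 0 ≤ TQ a n y := Int.fract_nonneg _

theorem qdigit_lt (ha : ∀ n, 1 ≤ a n) (y : ℝ) (n : ℕ) : qdigit a y n < a n := by
  have h : (0 : ℝ) < a n := by exact_mod_cast ha n
  rw [qdigit, Nat.floor_lt (mul_nonneg h.le (TQ_nonneg y n))]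
  exact mul_lt_of_lt_one_right h (Int.fract_lt_one _)

theorem floor_qprod_succ_mul (y : ℝ) (n : ℕ) :
    ⌊qprod a (n + 1) * y⌋ = a n * ⌊qprod a n * y⌋ + qdigit a y n := by
  have h : qprod a (n + 1) * y = ((a n * ⌊qprod a n * y⌋ : ℤ) : ℝ) + a n * TQ a n y := by
    rw [qprod_succ, TQ]
    push_cast
    rw [← mul_add, Int.floor_add_fract]
    ring
  rw [h, Int.floor_intCast_add, qdigit,
    Int.natCast_floor_eq_floor (mul_nonneg (Nat.cast_nonneg _) (TQ_nonneg y n))]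

theorem abs_sub_le_of_qdigit_eq (ha : ∀ n, 1 ≤ a n) {y y' : ℝ} (hy : y ∈ Set.Ico (0 : ℝ) 1)
    (hy' : y' ∈ Set.Ico (0 : ℝ) 1) {n : ℕ} (h : ∀ i < n, qdigit a y i = qdigit a y' i) :
    |y - y'| ≤ (qprod a n)⁻¹ := by
  have hfloor : ⌊qprod a n * y⌋ = ⌊qprod a n * y'⌋ := by
    induction n with
    | zero => simp [qprod, Int.floor_eq_zero_iff.2 hy, Int.floor_eq_zero_iff.2 hy']
    | succ n ih =>
      rw [floor_qprod_succ_mul, floor_qprod_succ_mul, ih fun i hi => h i (by omega),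
        h n (by omega)]
  have hpos := qprod_pos ha n
  have hlt := (Int.abs_sub_lt_one_of_floor_eq_floor hfloor).le
  rw [← mul_sub, abs_mul, abs_of_pos hpos] at hlt
  rwa [inv_eq_one_div, le_div_iff₀ hpos, mul_comm]

/-- A set of real numbers defined by free choice of the digits from intervals has dimension at
least `r` if the numbers of choices are large enough. -/
theorem le_dimH_of_digit_intervals {q lo : ℕ → ℕ} (hlo : ∀ n, lo n + a n + 1 ≤ q n)
    (ha : ∀ n, 1 ≤ a n) {r : NNReal} (hr : 0 < r) {C : ℝ}
    (hC : ∀ n, qprod q (n + 2) ^ (r : ℝ) ≤ C * qprod a n) :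
    (r : ENNReal) ≤ dimH {x : ℝ | ∀ n, lo n ≤ qdigit q x n ∧ qdigit q x n < lo n + a n} := by
  have hr' : (0 : ℝ) < r := hr
  have hq : ∀ n, 2 ≤ q n := fun n => by have := hlo n; have := ha n; omega
  have hqpos : ∀ n, 0 < qprod q n := qprod_pos fun n => by have := hq n; omega
  have hapos : ∀ n, 0 < qprod a n := qprod_pos ha
  have hC0 : 0 ≤ C := by
    by_contra! h
    have := (hC 0).trans (mul_nonpos_of_nonpos_of_nonneg h.le (hapos 0).le)
    exact absurd this (not_le.2 (Real.rpow_pos_of_pos (hqpos _) _))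
  let E : ℝ → ℕ → ℕ := fun y n => lo n + qdigit a y n
  have hE : ∀ y n, E y n + 2 ≤ q n := fun y n => by
    have := hlo n
    have := qdigit_lt ha y n
    simp only [E]
    omega
  let g : ℝ → ℝ := fun y => cantorTail q (E y) 0
  have hsub : g '' Set.Ico 0 1 ⊆
      {x : ℝ | ∀ n, lo n ≤ qdigit q x n ∧ qdigit q x n < lo n + a n} := by
    rintro _ ⟨y, -, rfl⟩ n
    rw [qdigit_cantorTail (hE y)]
    exact ⟨Nat.le_add_right _ _, Nat.add_lt_add_left (qdigit_lt ha y n) _⟩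
  have hinv : ∀ n, (qprod a n)⁻¹ ≤ C * (qprod q (n + 2))⁻¹ ^ (r : ℝ) := fun n => by
    rw [Real.inv_rpow (hqpos _).le, ← div_eq_mul_inv,
      le_div_iff₀ (Real.rpow_pos_of_pos (hqpos _) _), inv_mul_le_iff₀ (hapos n), mul_comm]
    exact hC n
  have hlim : Tendsto (fun n => C * (qprod q (n + 2))⁻¹ ^ (r : ℝ)) atTop (𝓝 0) := by
    have h1 : Tendsto (fun n => qprod q (n + 2)) atTop atTop := by
      refine tendsto_atTop_mono (fun n => ?_)
        ((tendsto_pow_atTop_atTop_of_one_lt (one_lt_two (α := ℝ))).comp (tendsto_add_atTop_nat 2))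
      calc ((fun n => (2 : ℝ) ^ n) ∘ fun n => n + 2) n
          = ∏ _i ∈ Finset.range (n + 2), (2 : ℝ) := by simp
        _ ≤ _ := Finset.prod_le_prod (fun _ _ => by norm_num) fun i _ => by exact_mod_cast hq i
    have h2 := (tendsto_rpow_atTop hr').comp h1
    have h3 := (tendsto_inv_atTop_zero.comp h2).const_mul C
    rw [mul_zero] at h3
    refine h3.congr fun n => ?_
    simp only [Function.comp]
    rw [Real.inv_rpow (hqpos _).le]
  have hholder : ∀ y ∈ Set.Ico (0 : ℝ) 1, ∀ y' ∈ Set.Ico (0 : ℝ) 1,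
      |y - y'| ≤ C * |g y - g y'| ^ (r : ℝ) := by
    intro y hy y' hy'
    by_cases hall : ∀ n, E y n = E y' n
    · have hdig : ∀ n, qdigit a y n = qdigit a y' n := fun n => Nat.add_left_cancel (hall n)
      have h0 : |y - y'| ≤ 0 := ge_of_tendsto' hlim fun n =>
        (abs_sub_le_of_qdigit_eq ha hy hy' fun i _ => hdig i).trans (hinv n)
      exact h0.trans (by positivity)
    · push Not at hall
      have hmin : ∀ i < Nat.find hall, E y i = E y' i := fun i hi =>
        not_not.1 (Nat.find_min hall hi)
      calc |y - y'| ≤ (qprod a (Nat.find hall))⁻¹ :=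
            abs_sub_le_of_qdigit_eq ha hy hy' fun i hi => Nat.add_left_cancel (hmin i hi)
        _ ≤ C * (qprod q (Nat.find hall + 2))⁻¹ ^ (r : ℝ) := hinv _
        _ ≤ _ := mul_le_mul_of_nonneg_left (Real.rpow_le_rpow (inv_nonneg.2 (hqpos _).le)
            (inv_qprod_le_abs_cantorTail_sub (hE y) (hE y') hmin (Nat.find_spec hall)) hr'.le) hC0
  have hinj : Set.InjOn g (Set.Ico 0 1) := fun y hy y' hy' h => by
    have := hholder y hy y' hy'
    rw [h, sub_self, abs_zero, Real.zero_rpow hr'.ne', mul_zero] at this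
    exact sub_eq_zero.1 (abs_nonpos_iff.1 this)
  let f : ℝ → ℝ := Function.invFunOn g (Set.Ico 0 1)
  have hfg : ∀ y ∈ Set.Ico (0 : ℝ) 1, f (g y) = y := fun y hy => hinj.leftInvOn_invFunOn hy
  have hf : HolderOnWith C.toNNReal r f (g '' Set.Ico 0 1) := by
    rintro _ ⟨y, hy, rfl⟩ _ ⟨y', hy', rfl⟩
    rw [hfg y hy, hfg y' hy', edist_dist, edist_dist, Real.dist_eq, Real.dist_eq,
      ENNReal.ofReal_rpow_of_nonneg (abs_nonneg _) hr'.le]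
    change _ ≤ ENNReal.ofReal C * _
    rw [← ENNReal.ofReal_mul hC0]
    exact ENNReal.ofReal_le_ofReal (hholder y hy y' hy')
  have himg : f '' (g '' Set.Ico 0 1) = Set.Ico 0 1 := by
    rw [Set.image_image]
    exact (Set.image_congr hfg).trans (Set.image_id' _)
  have hdim : dimH (Set.Ico (0 : ℝ) 1) = 1 := by
    rw [Real.dimH_of_nonempty_interior (by simp [interior_Ico])]
    simp
  have h1 := hf.dimH_image_le hr
  rw [himg, hdim, ENNReal.le_div_iff_mul_le (Or.inl (by exact_mod_cast hr.ne'))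
    (Or.inl ENNReal.coe_ne_top), one_mul] at h1
  exact h1.trans (dimH_mono hsub)

end Digits

theorem card_filter_range_le {p p' : ℕ → Prop} [DecidablePred p] [DecidablePred p'] {i₀ : ℕ}
    (h : ∀ i, i₀ ≤ i → p i → p' i) (n : ℕ) :
    ((Finset.range n).filter p).card ≤ ((Finset.range n).filter p').card + i₀ := by
  calc ((Finset.range n).filter p).card
      ≤ (((Finset.range n).filter p') ∪ Finset.range i₀).card := by
        refine Finset.card_le_card fun i hi => ?_
        rw [Finset.mem_filter] at hi
        rw [Finset.mem_union, Finset.mem_filter]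
        rcases le_or_gt i₀ i with hle | hlt
        · exact Or.inl ⟨hi.1, h i hle hi.2⟩
        · exact Or.inr (Finset.mem_range.2 hlt)
    _ ≤ _ := (Finset.card_union_le _ _).trans (by rw [Finset.card_range])

/-- The smallest admissible digit at position `n`: the prescribed one, or `q n / 2` at a free
position. -/
noncomputable def lowestDigit (q : ℕ → ℕ) (S : Set ℕ) (s : ℕ → ℕ) (n : ℕ) : ℕ :=
  (forcedDigit q S s n).getD (q n / 2)

/-- The number of admissible digits at position `n`. -/
noncomputable def digitChoices (q : ℕ → ℕ) (S : Set ℕ) (s : ℕ → ℕ) (n : ℕ) : ℕ :=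
  if forcedDigit q S s n = none then q n - 1 - q n / 2 else 1

/-- The numbers all of whose digits are admissible. -/
def admissibleSet (q : ℕ → ℕ) (S : Set ℕ) (s : ℕ → ℕ) : Set ℝ :=
  {x | ∀ n, lowestDigit q S s n ≤ qdigit q x n ∧
    qdigit q x n < lowestDigit q S s n + digitChoices q S s n}

section Admissible

variable {q : ℕ → ℕ} {S : Set ℕ} {s : ℕ → ℕ} {x : ℝ}

theorem qdigit_eq_of_mem_admissibleSet (hx : x ∈ admissibleSet q S s) {n e : ℕ}
    (h : forcedDigit q S s n = some e) : qdigit q x n = e := by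
  have := hx n
  simp only [lowestDigit, digitChoices, h, Option.getD_some, reduceCtorEq, if_false] at this
  omega

theorem half_le_qdigit_of_mem_admissibleSet (hx : x ∈ admissibleSet q S s) {n : ℕ}
    (h : forcedDigit q S s n = none) : q n / 2 ≤ qdigit q x n := by
  have := (hx n).1
  rwa [lowestDigit, h, Option.getD_none] at this

theorem blockCount_tendsto (hq : ∀ n, 1 ≤ q n) (hmono : Monotone q)
    (hinf : InfiniteInLimit q) (hdiv : FullyDivergent q)
    (hs : ∀ c, wordOffset (c + 1) ≤ q (s c)) (hsp : Sparse q s)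
    (hx : x ∈ admissibleSet q S s) {k : ℕ} (hk : 1 ≤ k) (B : Fin k → ℕ) :
    Tendsto (fun n => (blockCount q x B n : ℝ) / Qsum q k n) atTop
      (𝓝 (if k ∈ S then 1 else 0)) := by
  obtain ⟨i₀, hi₀⟩ := (hinf.eventually_ge_atTop (2 * (∑ j, B j + 1))).exists
  have hB : ∀ i, i₀ ≤ i → ∀ j, B j < q i / 2 := fun i hi j => by
    have h1 := hmono hi
    have h2 := Finset.single_le_sum (f := B) (fun _ _ => Nat.zero_le _) (Finset.mem_univ j)
    omega
  have hdigit : ∀ i, i₀ ≤ i → ∀ j, qdigit q x i = B j → forcedDigit q S s i = some (B j) := by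
    intro i hi j hj
    cases h : forcedDigit q S s i with
    | none =>
      have h1 := half_le_qdigit_of_mem_admissibleSet hx h
      have h2 := hB i hi j
      omega
    | some e => rw [← hj, qdigit_eq_of_mem_admissibleSet hx h]
  have hle : ∀ n, blockCount q x B n ≤ (forcedOccurrences q S s B n).card + i₀ :=
    card_filter_range_le (p := fun i => ∀ j : Fin k, qdigit q x (i + (j : ℕ)) = B j)
      (p' := fun i => ∀ j : Fin k, forcedDigit q S s (i + (j : ℕ)) = some (B j))
      fun i hi h j => hdigit _ (hi.trans (Nat.le_add_right _ _)) j (h j)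
  have hge : ∀ n, (forcedOccurrences q S s B n).card ≤ blockCount q x B n := fun n =>
    Finset.card_le_card (Finset.monotone_filter_right _ fun i _ h j =>
      qdigit_eq_of_mem_admissibleSet hx (h j))
  have hlim := forcedOccurrences_tendsto (S := S) hq hmono hinf hdiv hs hsp hk B
  have hzero : Tendsto (fun n => (i₀ : ℝ) / Qsum q k n) atTop (𝓝 0) :=
    (Qsum_tendsto_atTop hdiv k).const_div_atTop _
  have hupper := hlim.add hzero
  rw [add_zero] at hupper
  refine tendsto_of_tendsto_of_tendsto_of_le_of_le hlim hupper (fun n => ?_) fun n => ?_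
  · exact div_le_div_of_nonneg_right (Nat.cast_le.2 (hge n)) (Qsum_nonneg k n)
  · rw [← add_div, ← Nat.cast_add]
    exact div_le_div_of_nonneg_right (Nat.cast_le.2 (hle n)) (Qsum_nonneg k n)

theorem qNormalOfOrder_iff (hq : ∀ n, 1 ≤ q n) (hmono : Monotone q)
    (hinf : InfiniteInLimit q) (hdiv : FullyDivergent q)
    (hs : ∀ c, wordOffset (c + 1) ≤ q (s c)) (hsp : Sparse q s)
    (hx : x ∈ admissibleSet q S s) {k : ℕ} (hk : 1 ≤ k) : QNormalOfOrder q k x ↔ k ∈ S := by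
  have hlim := blockCount_tendsto hq hmono hinf hdiv hs hsp hx hk
  refine ⟨fun h => ?_, fun h B => by simpa [h] using hlim B⟩
  by_contra hkS
  have := tendsto_nhds_unique (h fun _ => 0) (hlim fun _ => 0)
  simp [hkS] at this

theorem lowestDigit_add_digitChoices_lt (h4 : ∀ n, 4 ≤ q n) (hmono : Monotone q)
    (hs : ∀ c, wordOffset (c + 1) ≤ q (s c)) (hs' : ∀ c, ∀ e ∈ codeWord c, 2 * e + 2 ≤ q (s c))
    (n : ℕ) : lowestDigit q S s n + digitChoices q S s n + 1 ≤ q n := by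
  have hn := h4 n
  cases h : forcedDigit q S s n with
  | none =>
    simp only [lowestDigit, digitChoices, h, Option.getD_none, if_true]
    omega
  | some e =>
    have := forcedDigit_lt (fun n => (by norm_num : 1 ≤ 4).trans (h4 n)) hmono hs hs' h
    simp only [lowestDigit, digitChoices, h, Option.getD_some, reduceCtorEq, if_false]
    omega

theorem one_le_digitChoices (h4 : ∀ n, 4 ≤ q n) (n : ℕ) : 1 ≤ digitChoices q S s n := by
  have := h4 n
  unfold digitChoices
  split_ifs <;> omega

theorem le_four_mul_digitChoices (h4 : ∀ n, 4 ≤ q n) {n : ℕ}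
    (h : forcedDigit q S s n = none) : q n ≤ 4 * digitChoices q S s n := by
  have := h4 n
  rw [digitChoices, if_pos h]
  omega

end Admissible

section Growth

theorem log_slowSeq_pos (n : ℕ) : 0 < Real.log (slowSeq n) :=
  Real.log_pos (by exact_mod_cast (by have := eight_le_slowSeq n; omega : 1 < slowSeq n))

theorem log_slowSeq_mono {m n : ℕ} (h : m ≤ n) :
    Real.log (slowSeq m) ≤ Real.log (slowSeq n) :=
  Real.log_le_log (by exact_mod_cast (by have := eight_le_slowSeq m; omega : 0 < slowSeq m))
    (by exact_mod_cast slowSeq_mono h)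

theorem log_slowSeq_le_two_mul {m n : ℕ} (h : slowSeq n ≤ slowSeq m + 1) :
    Real.log (slowSeq n) ≤ 2 * Real.log (slowSeq m) := by
  have h8 := eight_le_slowSeq m
  have h8' := eight_le_slowSeq n
  have hsq : slowSeq n ≤ slowSeq m ^ 2 := by nlinarith
  have := Real.log_le_log (by exact_mod_cast (by omega : 0 < slowSeq n))
    (by exact_mod_cast hsq : (slowSeq n : ℝ) ≤ (slowSeq m : ℝ) ^ 2)
  rwa [Real.log_pow, Nat.cast_ofNat] at this

theorem mul_log_slowSeq_le_sum (n : ℕ) :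
    n * Real.log (slowSeq n) ≤ 4 * ∑ i ∈ Finset.range n, Real.log (slowSeq i) := by
  have h1 : ((n - n / 2 : ℕ) : ℝ) * Real.log (slowSeq (n / 2)) ≤
      ∑ i ∈ Finset.range n, Real.log (slowSeq i) := by
    calc ((n - n / 2 : ℕ) : ℝ) * Real.log (slowSeq (n / 2))
        = ∑ _i ∈ Finset.Ico (n / 2) n, Real.log (slowSeq (n / 2)) := by simp
      _ ≤ ∑ i ∈ Finset.Ico (n / 2) n, Real.log (slowSeq i) :=
        Finset.sum_le_sum fun i hi => log_slowSeq_mono (Finset.mem_Ico.1 hi).1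
      _ ≤ _ := Finset.sum_le_sum_of_subset_of_nonneg
        (fun i hi => Finset.mem_range.2 (Finset.mem_Ico.1 hi).2) fun i _ _ => (log_slowSeq_pos i).le
  have h2 := log_slowSeq_le_two_mul (slowSeq_le_half n)
  have h3 : (n : ℝ) ≤ 2 * (n - n / 2 : ℕ) := by exact_mod_cast (by omega : n ≤ 2 * (n - n / 2))
  have h4 := log_slowSeq_pos n
  calc n * Real.log (slowSeq n)
      ≤ (2 * (n - n / 2 : ℕ)) * (2 * Real.log (slowSeq (n / 2))) := by gcongr
    _ = 4 * ((n - n / 2 : ℕ) * Real.log (slowSeq (n / 2))) := by ring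
    _ ≤ _ := by gcongr

theorem log_qprod {q : ℕ → ℕ} (hq : ∀ n, 1 ≤ q n) (n : ℕ) :
    Real.log (qprod q n) = ∑ i ∈ Finset.range n, Real.log (q i) :=
  Real.log_prod fun i _ => by exact_mod_cast (by have := hq i; omega : q i ≠ 0)

theorem le_log_qprod {a : ℕ → ℕ} {F : ℕ → Prop} [DecidablePred F] (ha : ∀ n, 1 ≤ a n)
    (hF : ∀ n, ¬ F n → slowSeq n ≤ 4 * a n) (n : ℕ) :
    ∑ i ∈ Finset.range n, Real.log (slowSeq i) - n * Real.log 4 -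
      ((Finset.range n).filter F).card * Real.log (slowSeq n) ≤ Real.log (qprod a n) := by
  have hterm : ∀ i ∈ Finset.range n, Real.log (slowSeq i) - Real.log 4 -
      (if F i then Real.log (slowSeq n) else 0) ≤ Real.log (a i) := by
    intro i hi
    split_ifs with h
    · have h1 := log_slowSeq_mono (Finset.mem_range.1 hi).le
      have h2 : 0 ≤ Real.log 4 := Real.log_nonneg (by norm_num)
      have h3 : 0 ≤ Real.log (a i) := Real.log_nonneg (by exact_mod_cast ha i)
      linarith
    · have hai : (0 : ℝ) < a i := by exact_mod_cast ha i
      have h8 := eight_le_slowSeq i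
      have := Real.log_le_log (by exact_mod_cast (by omega : 0 < slowSeq i))
        (by exact_mod_cast hF i h : (slowSeq i : ℝ) ≤ 4 * a i)
      rw [Real.log_mul (by norm_num) hai.ne'] at this
      linarith
  have := Finset.sum_le_sum hterm
  rw [Finset.sum_sub_distrib, Finset.sum_sub_distrib, ← Finset.sum_filter] at this
  simp only [Finset.sum_const, Finset.card_range, nsmul_eq_mul] at this
  rwa [log_qprod ha]

theorem exists_qprod_rpow_le {a : ℕ → ℕ} {F : ℕ → Prop} [DecidablePred F] (ha : ∀ n, 1 ≤ a n)
    (hF : ∀ n, ¬ F n → slowSeq n ≤ 4 * a n)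
    (hdens : (fun n => (((Finset.range n).filter F).card : ℝ)) =o[atTop] fun n => (n : ℝ))
    {r : ℝ} (hr : r < 1) :
    ∃ C, ∀ n, qprod slowSeq (n + 2) ^ r ≤ C * qprod a n := by
  have hq : ∀ n, 1 ≤ slowSeq n := fun n => (by norm_num : 1 ≤ 8).trans (eight_le_slowSeq n)
  set δ : ℝ := (1 - r) / 12 with hδ
  have hδ0 : 0 < δ := by rw [hδ]; linarith
  have hlogtop : Tendsto (fun n => Real.log (slowSeq n)) atTop atTop :=
    Real.tendsto_log_atTop.comp (tendsto_natCast_atTop_atTop.comp slowSeq_tendsto)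
  have hev : ∀ᶠ n in atTop, qprod slowSeq (n + 2) ^ r ≤ qprod a n := by
    filter_upwards [hdens.bound hδ0, hlogtop.eventually_ge_atTop (Real.log 4 / δ),
      (tendsto_natCast_atTop_atTop (R := ℝ)).eventually_ge_atTop (3 / δ)] with n h1 h2 h3
    rw [Real.norm_natCast, Real.norm_natCast] at h1
    rw [div_le_iff₀ hδ0] at h2 h3
    rw [← Real.log_le_log_iff (Real.rpow_pos_of_pos (qprod_pos hq _) _) (qprod_pos ha _),
      Real.log_rpow (qprod_pos hq _), log_qprod hq, Finset.sum_range_succ, Finset.sum_range_succ]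
    refine le_trans ?_ (le_log_qprod ha hF n)
    have h4 := mul_log_slowSeq_le_sum n
    have h5 := log_slowSeq_le_two_mul (slowSeq_succ_le n)
    have h6 := log_slowSeq_pos n
    set L := Real.log (slowSeq n)
    set T := ∑ i ∈ Finset.range n, Real.log (slowSeq i)
    have hn : (0 : ℝ) ≤ n := Nat.cast_nonneg n
    have e1 : (((Finset.range n).filter F).card : ℝ) * L ≤ δ * n * L := by gcongr
    have e2 : n * Real.log 4 ≤ n * (L * δ) := by gcongr
    have e3 : 3 * L ≤ n * δ * L := by gcongr
    have e4 : 12 * δ * (n * L) ≤ 12 * δ * (4 * T) := by gcongr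
    have e5 : r * (L + Real.log (slowSeq (n + 1))) ≤ 1 * (3 * L) := by
      have := log_slowSeq_pos (n + 1)
      exact mul_le_mul hr.le (by linarith) (by linarith) zero_le_one
    have e6 : 12 * δ = 1 - r := by rw [hδ]; ring
    have e7 : 12 * δ * (4 * T) = 4 * T - 4 * (r * T) := by rw [e6]; ring
    have e8 : r * (T + L + Real.log (slowSeq (n + 1))) =
      r * T + r * (L + Real.log (slowSeq (n + 1))) := by ring
    rw [e8]
    linarith
  have hO : (fun n => qprod slowSeq (n + 2) ^ r) =O[atTop] qprod a := by
    refine Asymptotics.IsBigO.of_bound 1 (hev.mono fun n hn => ?_)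
    rwa [one_mul, Real.norm_of_nonneg (Real.rpow_nonneg (qprod_pos hq _).le _),
      Real.norm_of_nonneg (qprod_pos ha _).le]
  obtain ⟨C, -, hC⟩ := Asymptotics.bound_of_isBigO_nat_atTop hO
  refine ⟨C, fun n => ?_⟩
  have := hC (x := n) (qprod_pos ha n).ne'
  rwa [Real.norm_of_nonneg (Real.rpow_nonneg (qprod_pos hq _).le _),
    Real.norm_of_nonneg (qprod_pos ha _).le] at this

end Growth

theorem one_le_dimH_admissibleSet (S : Set ℕ) {s : ℕ → ℕ}
    (hs : ∀ c, wordOffset (c + 1) ≤ slowSeq (s c))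
    (hs' : ∀ c, ∀ e ∈ codeWord c, 2 * e + 2 ≤ slowSeq (s c)) (hsp : Sparse slowSeq s) :
    1 ≤ dimH (admissibleSet slowSeq S s) := by
  have h4 : ∀ n, 4 ≤ slowSeq n := fun n => (by norm_num : 4 ≤ 8).trans (eight_le_slowSeq n)
  have hq : ∀ n, 1 ≤ slowSeq n := fun n => (by norm_num : 1 ≤ 4).trans (h4 n)
  have hdens : (fun n => (((Finset.range n).filter fun i =>
      forcedDigit slowSeq S s i ≠ none).card : ℝ)) =o[atTop] fun n => (n : ℝ) := by
    have h := longWordMass_isLittleO (S := S) hq slowSeq_tendsto slowSeq_fullyDivergent hsp 0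
    rw [funext (Qsum_zero_left (q := slowSeq))] at h
    refine (Asymptotics.IsBigO.of_bound 1 (Eventually.of_forall fun n => ?_)).trans_isLittleO h
    rw [one_mul, Real.norm_natCast, Real.norm_natCast]
    exact_mod_cast card_forced_le hq slowSeq_mono hs n
  refine ENNReal.le_of_forall_nnreal_lt fun r hr => ?_
  rcases eq_or_ne r 0 with rfl | hr0
  · simp
  obtain ⟨C, hC⟩ := exists_qprod_rpow_le (one_le_digitChoices h4)
    (fun n hn => le_four_mul_digitChoices h4 (not_not.1 hn)) hdens
    (by exact_mod_cast hr)
  exact le_dimH_of_digit_intervals (lowestDigit_add_digitChoices_lt h4 slowSeq_mono hs hs')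
    (one_le_digitChoices h4) (pos_iff_ne_zero.2 hr0) hC

/-- If `S` is almost closed under addition and its indicator function is computable, then
there is a computable, fully divergent, infinite in limit basic sequence `Q` such that
`dim_H(⋂_{k∈S} N_k(Q) \ ⋃_{k∉S} N_k(Q)) = 1`. -/
theorem stmt2 (S : Set ℕ) (hSpos : 0 ∉ S) (hS : AlmostClosed S)
    (hScomp : Computable fun k : ℕ => if k ∈ S then (1 : ℕ) else 0) :
    ∃ Q : ℕ → ℕ, Computable Q ∧ IsBasic Q ∧ FullyDivergent Q ∧ InfiniteInLimit Q ∧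
      dimH ((⋂ k ∈ S, {x : ℝ | QNormalOfOrder Q k x}) \
        ⋃ k ∈ {k : ℕ | 1 ≤ k ∧ k ∉ S}, {x : ℝ | QNormalOfOrder Q k x}) = 1 := by
  have hq : ∀ n, 1 ≤ slowSeq n := fun n => (by norm_num : 1 ≤ 8).trans (eight_le_slowSeq n)
  obtain ⟨s, hs, hs', hsp⟩ := exists_startTimes hq slowSeq_tendsto slowSeq_fullyDivergent
  refine ⟨slowSeq, computable_slowSeq, fun n => (by norm_num : 2 ≤ 8).trans (eight_le_slowSeq n),
    slowSeq_fullyDivergent, slowSeq_tendsto, le_antisymm ?_ ?_⟩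
  · exact (dimH_mono (Set.subset_univ _)).trans_eq Real.dimH_univ
  · refine (one_le_dimH_admissibleSet S hs hs' hsp).trans (dimH_mono fun x hx => ?_)
    have hiff : ∀ k, 1 ≤ k → (QNormalOfOrder slowSeq k x ↔ k ∈ S) := fun k hk =>
      qNormalOfOrder_iff hq slowSeq_mono slowSeq_tendsto slowSeq_fullyDivergent hs hsp hx hk
    refine ⟨Set.mem_iInter₂.2 fun k hk => (hiff k ?_).2 hk, fun h => ?_⟩
    · exact Nat.pos_of_ne_zero fun h0 => hSpos (h0 ▸ hk)
    · obtain ⟨k, ⟨hk1, hkS⟩, hk⟩ := Set.mem_iUnion₂.1 h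
      exact hkS ((hiff k hk1).1 hk)
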